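/- arXiv:2005.05913 — 2 statements merged into one kernel-verified Lean document; each statement's English description precedes it below -/
import Mathlib

section
/- Let p ∈ [1, 2] and let q be its conjugate exponent (1/p + 1/q = 1). Let Z ⊂ ℝ^n be a compact convex set and let d : Z → ℝ be differentiable and 1-strongly convex with respect to ‖·‖_p on Z; let V_x(y) = d(y) − d(x) − ⟨∇d(x), y − x⟩ be the associated Bregman divergence. Let ρ > 0, let γ_1, …, γ_N > 0, and let Δ_1, …, Δ_N ∈ ℝ^n. Let v_1 ∈ Z and Ω > 0 satisfy V_{v_1}(u) ≤ Ω²/2 for all u ∈ Z, and define recursively v_{k+1} = argmin_{y ∈ Z} ( V_{v_k}(y) − ρ·γ_k·⟨Δ_k, y⟩ ). Then for every u ∈ Z: ∑_{k=1}^N γ_k·⟨−Δ_k, v_k − u⟩ ≤ Ω²/(2ρ) + (ρ/2)·∑_{k=1}^N γ_k²·‖Δ_k‖_q². -/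
open MeasureTheory ENNReal

/-- The `ℓ_p` norm of a vector in `ℝ^n`, for real `p ∈ [1, ∞)`. -/
noncomputable def lpnorm {n : ℕ} (p : ℝ) (x : Fin n → ℝ) : ℝ :=
  (∑ i, |x i| ^ p) ^ (1 / p)

/-- The `ℓ_q` norm of a vector in `ℝ^n`, for `q ∈ [1, ∞]` (extended-real exponent). -/
noncomputable def lpnormE {n : ℕ} (q : ℝ≥0∞) (x : Fin n → ℝ) : ℝ :=
  if q = ⊤ then ⨆ i, |x i| else (∑ i, |x i| ^ q.toReal) ^ (1 / q.toReal)

/-- The standard inner product `⟨a, b⟩ = ∑ i, a i * b i` on `ℝ^n`. -/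
noncomputable def rdot {n : ℕ} (a b : Fin n → ℝ) : ℝ := ∑ i, a i * b i

/-- The continuous linear functional `v ↦ ∑ i, a i * v i` on `ℝ^n`. -/
noncomputable def toCLM {n : ℕ} (a : Fin n → ℝ) : (Fin n → ℝ) →L[ℝ] ℝ :=
  LinearMap.toContinuousLinearMap
    (∑ i, a i • (LinearMap.proj i : (Fin n → ℝ) →ₗ[ℝ] ℝ))

theorem rdot_holder {n : ℕ} (p : ℝ) (hp1 : 1 ≤ p) (q : ℝ≥0∞)
    (hpq : 1 / ENNReal.ofReal p + 1 / q = 1) (a b : Fin n → ℝ) :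
    rdot a b ≤ lpnormE q a * lpnorm p b := by
  rcases eq_or_lt_of_le hp1 with h1 | h1
  · subst h1
    have hq : q = ⊤ := by
      have h0 : (1 : ℝ≥0∞) + 1 / q = 1 + 0 := by simpa using hpq
      have := (ENNReal.add_right_inj ENNReal.one_ne_top).1 h0
      simpa using this
    subst hq
    simp only [rdot, lpnormE, lpnorm, if_true, Real.rpow_one, div_one, Finset.mul_sum]
    refine Finset.sum_le_sum fun i _ => ?_
    refine (le_abs_self _).trans ?_
    rw [abs_mul]
    refine mul_le_mul_of_nonneg_right ?_ (abs_nonneg _)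
    exact le_ciSup (f := fun i => |a i|) (Set.finite_range _).bddAbove i
  · have hp0 : 0 < p := by linarith
    have hq : q ≠ ⊤ := by
      rintro rfl
      simp only [one_div, ENNReal.inv_top, add_zero, ENNReal.inv_eq_one] at hpq
      have := ENNReal.ofReal_eq_one.1 hpq
      linarith
    have hq0 : q ≠ 0 := by
      rintro rfl
      simp at hpq
    have hc : p⁻¹ + q.toReal⁻¹ = 1 := by
      have := congrArg ENNReal.toReal hpq
      rw [one_div, one_div, ENNReal.toReal_add (by simp [hp0]) (by simp [hq0])] at this
      simpa [ENNReal.toReal_inv, ENNReal.toReal_ofReal hp0.le] using this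
    have hconj : p.HolderConjugate q.toReal := Real.holderConjugate_iff.2 ⟨h1, hc⟩
    have := Real.inner_le_Lp_mul_Lq Finset.univ a b hconj.symm
    simpa only [rdot, lpnormE, lpnorm, if_neg hq] using this

theorem toCLM_apply' {n : ℕ} (a x : Fin n → ℝ) : toCLM a x = rdot a x := by
  simp [toCLM, rdot]

theorem rdot_sub' {n : ℕ} (a x y : Fin n → ℝ) : rdot a (x - y) = rdot a x - rdot a y := by
  simp [rdot, mul_sub]

theorem rdot_neg' {n : ℕ} (a x : Fin n → ℝ) : rdot (-a) x = - rdot a x := by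
  simp [rdot]

theorem prox_opt {n : ℕ} (Z : Set (Fin n → ℝ)) (hZconv : Convex ℝ Z)
    (d : (Fin n → ℝ) → ℝ) (g h D w : Fin n → ℝ) (c e : ℝ) (hw : w ∈ Z)
    (hd : HasFDerivWithinAt d (toCLM g) Z w) (x : Fin n → ℝ)
    (hmin : IsMinOn (fun y => d y - e - rdot h (y - x) - c * rdot D y) Z w)
    (u : Fin n → ℝ) (hu : u ∈ Z) :
    0 ≤ rdot g (u - w) - rdot h (u - w) - c * rdot D (u - w) := by
  have hF : HasFDerivWithinAt (fun y => d y - e - rdot h (y - x) - c * rdot D y)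
      (toCLM g - toCLM h - c • toCLM D) Z w := by
    have e1 : (fun y => d y - e - rdot h (y - x) - c * rdot D y)
        = fun y => d y - e - (toCLM h y - rdot h x) - c * toCLM D y := by
      funext y; rw [rdot_sub', toCLM_apply', toCLM_apply']
    rw [e1]
    exact ((hd.sub_const e).sub
      (((toCLM h).hasFDerivWithinAt).sub_const _)).sub
      (((toCLM D).hasFDerivWithinAt).const_mul c)
  have := hmin.localize.hasFDerivWithinAt_nonneg hF
    (sub_mem_posTangentConeAt_of_segment_subset (hZconv.segment_subset hw hu))
  simpa [toCLM_apply'] using this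

/-- Lemma 4 auxiliary sequence bound: `p ∈ [1, 2]` with conjugate `q`,
`Z ⊂ ℝ^n` compact convex, `d` differentiable (gradient `gd`) and 1-strongly convex w.r.t.
`‖·‖_p` on `Z` with Bregman divergence `V`, `ρ > 0`, steps `γ_k > 0`, vectors `Δ_k`,
`v_1 ∈ Z` with `V_{v_1}(u) ≤ Ω²/2` on `Z`, and `v_{k+1} = argmin_{y ∈ Z}(V_{v_k}(y) − ργ_k⟨Δ_k, y⟩)`.
Then `∑_{k=1}^N γ_k⟨−Δ_k, v_k − u⟩ ≤ Ω²/(2ρ) + (ρ/2)∑_{k=1}^N γ_k²‖Δ_k‖_q²` for all `u ∈ Z`. -/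
theorem statement4 (n N : ℕ) (p : ℝ) (hp1 : 1 ≤ p) (hp2 : p ≤ 2)
    (q : ℝ≥0∞) (hpq : 1 / ENNReal.ofReal p + 1 / q = 1)
    (Z : Set (Fin n → ℝ)) (hZc : IsCompact Z) (hZconv : Convex ℝ Z)
    (d : (Fin n → ℝ) → ℝ) (gd : (Fin n → ℝ) → Fin n → ℝ)
    (hdiff : ∀ x ∈ Z, HasFDerivWithinAt d (toCLM (gd x)) Z x)
    (hstrong : ∀ x ∈ Z, ∀ y ∈ Z,
      d x + rdot (gd x) (y - x) + (1 / 2) * (lpnorm p (y - x)) ^ 2 ≤ d y)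
    (V : (Fin n → ℝ) → (Fin n → ℝ) → ℝ)
    (hV : ∀ x y, V x y = d y - d x - rdot (gd x) (y - x))
    (ρ : ℝ) (hρ : 0 < ρ)
    (γ : ℕ → ℝ) (hγ : ∀ k, 0 < γ k)
    (Δ : ℕ → Fin n → ℝ)
    (v : ℕ → Fin n → ℝ) (hv1 : v 1 ∈ Z)
    (Ωd : ℝ) (hΩd : ∀ u ∈ Z, V (v 1) u ≤ Ωd ^ 2 / 2) (hΩpos : 0 < Ωd)
    (hrec : ∀ k, 1 ≤ k → k ≤ N → v (k + 1) ∈ Z ∧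
      IsMinOn (fun y => V (v k) y - ρ * γ k * rdot (Δ k) y) Z (v (k + 1))) :
    ∀ u ∈ Z,
      ∑ k ∈ Finset.Icc 1 N, γ k * rdot (-(Δ k)) (v k - u) ≤
        Ωd ^ 2 / (2 * ρ) + (ρ / 2) * ∑ k ∈ Finset.Icc 1 N, (γ k) ^ 2 * (lpnormE q (Δ k)) ^ 2 := by
  intro u hu
  have hmem : ∀ k, 1 ≤ k → k ≤ N + 1 → v k ∈ Z := by
    intro k h1 h2
    rcases Nat.lt_or_ge 1 k with h | h
    · obtain ⟨m, rfl⟩ : ∃ m, k = m + 1 := ⟨k - 1, by omega⟩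
      exact (hrec m (by omega) (by omega)).1
    · have : k = 1 := by omega
      subst this; exact hv1
  have step : ∀ k, 1 ≤ k → k ≤ N → ρ * (γ k * rdot (-(Δ k)) (v k - u)) ≤
      V (v k) u - V (v (k+1)) u + ρ ^ 2 / 2 * ((γ k) ^ 2 * (lpnormE q (Δ k)) ^ 2) := by
    intro k h1 h2
    obtain ⟨hw, hmin⟩ := hrec k h1 h2
    have hvk := hmem k h1 (by omega)
    simp only [hV] at hmin
    have ho := prox_opt Z hZconv d _ _ _ _ _ _ hw (hdiff _ hw) _ hmin u hu
    have hs := hstrong _ hvk _ hw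
    have hh := rdot_holder p hp1 q hpq (Δ k) (v (k+1) - v k)
    have hh' := mul_le_mul_of_nonneg_left hh (mul_pos hρ (hγ k)).le
    have hsq := sq_nonneg (ρ * γ k * lpnormE q (Δ k) - lpnorm p (v (k+1) - v k))
    rw [hV, hV, rdot_neg']
    simp only [rdot_sub'] at *
    nlinarith
  have hsum : ∀ m, m ≤ N → ρ * ∑ k ∈ Finset.Icc 1 m, γ k * rdot (-(Δ k)) (v k - u) ≤
      V (v 1) u - V (v (m+1)) u
        + ρ ^ 2 / 2 * ∑ k ∈ Finset.Icc 1 m, (γ k) ^ 2 * (lpnormE q (Δ k)) ^ 2 := by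
    intro m
    induction m with
    | zero => intro _; simp
    | succ m ih =>
      intro hm
      have := ih (by omega)
      have hs := step (m+1) (by omega) hm
      rw [Finset.sum_Icc_succ_top (by omega), Finset.sum_Icc_succ_top (by omega), mul_add, mul_add]
      linarith
  have h := hsum N le_rfl
  have hpos : 0 ≤ V (v (N+1)) u := by
    have := hstrong _ (hmem (N+1) (by omega) le_rfl) u hu
    have h2 := sq_nonneg (lpnorm p (u - v (N+1)))
    rw [hV]; linarith
  have hO := hΩd u hu
  refine le_of_mul_le_mul_left ?_ hρ
  have e : ρ * (Ωd ^ 2 / (2 * ρ)) = Ωd ^ 2 / 2 := by field_simp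
  rw [mul_add, e]
  nlinarith
end

section
/- Let Z ⊂ ℝ^n be a convex set, let d : Z → ℝ be differentiable and convex, and let V_x(y) = d(y) − d(x) − ⟨∇d(x), y − x⟩ be the associated Bregman divergence. Let z ∈ Z, w ∈ ℝ^n, and let z₊ = argmin_{y ∈ Z} ( V_z(y) + ⟨w, y⟩ ). Then for every u ∈ Z: ⟨w, z₊ − u⟩ ≤ V_z(u) − V_{z₊}(u) − V_z(z₊). -/
open MeasureTheory

/-- prox-operator three-point inequality: `Z ⊂ ℝ^n` convex, `d` differentiable
(gradient `gd`) and convex on `Z`, Bregman divergence `V_x(y) = d(y) − d(x) − ⟨∇d(x), y − x⟩`,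
`z ∈ Z`, `w ∈ ℝ^n`, `z₊ = argmin_{y ∈ Z}(V_z(y) + ⟨w, y⟩)`. Then for all `u ∈ Z`,
`⟨w, z₊ − u⟩ ≤ V_z(u) − V_{z₊}(u) − V_z(z₊)`. -/
theorem statement7 (n : ℕ) (Z : Set (Fin n → ℝ)) (hZconv : Convex ℝ Z)
    (d : (Fin n → ℝ) → ℝ) (gd : (Fin n → ℝ) → Fin n → ℝ)
    (hdiff : ∀ x ∈ Z, HasFDerivWithinAt d (toCLM (gd x)) Z x)
    (hconv : ConvexOn ℝ Z d)
    (V : (Fin n → ℝ) → (Fin n → ℝ) → ℝ)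
    (hV : ∀ x y, V x y = d y - d x - rdot (gd x) (y - x))
    (z : Fin n → ℝ) (hz : z ∈ Z) (w : Fin n → ℝ)
    (zp : Fin n → ℝ) (hzp : zp ∈ Z)
    (hmin : IsMinOn (fun y => V z y + rdot w y) Z zp) :
    ∀ u ∈ Z, rdot w (zp - u) ≤ V z u - V zp u - V z zp := by
  intro u hu
  have hdot : ∀ a v : Fin n → ℝ, toCLM a v = rdot a v := by
    intro a v
    simp [toCLM, rdot]
  have hfun : (fun y => V z y + rdot w y)
      = fun y => d y - d z - toCLM (gd z) (y - z) + toCLM w y := by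
    funext y
    rw [hV, hdot, hdot]
  have h1 : HasFDerivWithinAt (fun y => V z y + rdot w y)
      (toCLM (gd zp) - toCLM (gd z) + toCLM w) Z zp := by
    rw [hfun]
    have h2 : HasFDerivWithinAt (fun y => toCLM (gd z) (y - z)) (toCLM (gd z)) Z zp := by
      simp only [map_sub]
      exact (toCLM (gd z)).hasFDerivWithinAt.sub_const _
    exact (((hdiff zp hzp).sub_const _).sub h2).add (toCLM w).hasFDerivWithinAt
  have h3 := hmin.localize.hasFDerivWithinAt_nonneg h1
    (sub_mem_posTangentConeAt_of_segment_subset (hZconv.segment_subset hzp hu))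
  simp only [hV, ← hdot]
  simp only [ContinuousLinearMap.add_apply, ContinuousLinearMap.sub_apply, map_sub] at h3 ⊢
  linarith
end
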